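/- For every real ε > 0 there exists a constant C > 0, depending only on ε, such that for every positive integer n the minimum weight of a biclique covering of G_Δ^n satisfies Cov(G_Δ^n) ≤ C·n^{1+ε}. -/

import Mathlib

open Finset

section GraphDefs

variable {α β : Type*}

/-- `(p.1, p.2)` is a biclique of the bipartite graph `(A, B, E)`. -/
def IsBiclique (A : Finset α) (B : Finset β) (E : Finset (α × β))
    (p : Finset α × Finset β) : Prop :=
  p.1 ⊆ A ∧ p.2 ⊆ B ∧ p.1 ×ˢ p.2 ⊆ E

/-- `C` is a biclique covering of the bipartite graph `(A, B, E)`. -/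
def IsBicliqueCover (A : Finset α) (B : Finset β) (E : Finset (α × β))
    (C : Finset (Finset α × Finset β)) : Prop :=
  (∀ p ∈ C, IsBiclique A B E p) ∧ ∀ e ∈ E, ∃ p ∈ C, e.1 ∈ p.1 ∧ e.2 ∈ p.2

/-- The minimum weight of a biclique covering of the bipartite graph `(A, B, E)`. -/
noncomputable def Cov (A : Finset α) (B : Finset β) (E : Finset (α × β)) : ℕ :=
  sInf {w | ∃ C : Finset (Finset α × Finset β),
    IsBicliqueCover A B E C ∧ w = ∑ p ∈ C, (p.1.card + p.2.card)}

/-- Vertices available to a rectifier network over classes `α` and `β`: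
sources come from `α`, sinks from `β`, and inner nodes are indexed by `ℕ`. -/
abbrev RVert (α β : Type*) := α ⊕ β ⊕ ℕ

/-- A rectifier network realizing the bipartite graph `(A, B, E)`:
a finite DAG whose set of source vertices is (a copy of) `A`, whose set of sink
vertices is (a copy of) `B`, and in which `b` is reachable from `a` iff `(a, b) ∈ E`. -/
structure RectNet (A : Finset α) (B : Finset β) (E : Finset (α × β)) where
  V : Finset (RVert α β)
  Ed : Finset (RVert α β × RVert α β)
  mem_fst : ∀ e ∈ Ed, e.1 ∈ V
  mem_snd : ∀ e ∈ Ed, e.2 ∈ V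
  acyclic : ∀ v, ¬ Relation.TransGen (fun x y => (x, y) ∈ Ed) v v
  memA : ∀ a ∈ A, (Sum.inl a : RVert α β) ∈ V
  memB : ∀ b ∈ B, (Sum.inr (Sum.inl b) : RVert α β) ∈ V
  sources : ∀ v ∈ V, (∀ u, (u, v) ∉ Ed) ↔ ∃ a ∈ A, v = Sum.inl a
  sinks : ∀ v ∈ V, (∀ u, (v, u) ∉ Ed) ↔ ∃ b ∈ B, v = Sum.inr (Sum.inl b)
  realizes : ∀ a ∈ A, ∀ b ∈ B,
    ((a, b) ∈ E ↔ Relation.ReflTransGen (fun x y => (x, y) ∈ Ed)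
      (Sum.inl a) (Sum.inr (Sum.inl b)))

/-- The size of a rectifier network: its number of edges. -/
def RectNet.size {A : Finset α} {B : Finset β} {E : Finset (α × β)}
    (R : RectNet A B E) : ℕ := R.Ed.card

/-- The network has depth at most `k`: there is no directed path with `k + 1` edges. -/
def RectNet.DepthLE {A : Finset α} {B : Finset β} {E : Finset (α × β)}
    (R : RectNet A B E) (k : ℕ) : Prop :=
  ∀ f : ℕ → RVert α β, ∃ i ≤ k, (f i, f (i + 1)) ∉ R.Ed

/-- The minimum size of a rectifier network realizing `(A, B, E)`. -/
noncomputable def Rect (A : Finset α) (B : Finset β) (E : Finset (α × β)) : ℕ :=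
  sInf {n | ∃ R : RectNet A B E, R.size = n}

/-- The minimum size of a rectifier network of depth at most `k` realizing `(A, B, E)`. -/
noncomputable def RectDepth (k : ℕ) (A : Finset α) (B : Finset β) (E : Finset (α × β)) : ℕ :=
  sInf {n | ∃ R : RectNet A B E, R.DepthLE k ∧ R.size = n}

/-- `κ(G)`: the maximum of `|A'|·|B'| / (|A'| + |B'|)` over nonempty bicliques of `(A, B, E)`. -/
noncomputable def kappa (A : Finset α) (B : Finset β) (E : Finset (α × β)) : ℝ :=
  sSup {h | ∃ p : Finset α × Finset β, IsBiclique A B E p ∧ p.1.Nonempty ∧ p.2.Nonempty ∧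
    h = ((p.1.card : ℝ) * (p.2.card : ℝ)) / ((p.1.card : ℝ) + (p.2.card : ℝ))}

end GraphDefs

/-- The edge set of the graph `G_Δ^n`: both vertex classes are `{1, …, n}` and `(i, j)` is
an edge iff the circular distance `min(|i − j|, n − |i − j|)` is at most `n/4`. -/
def deltaEdges (n : ℕ) : Finset (ℕ × ℕ) :=
  (Finset.Icc 1 n ×ˢ Finset.Icc 1 n).filter
    (fun p => min (Nat.dist p.1 p.2) (n - Nat.dist p.1 p.2) ≤ n / 4)

/-- The dyadic biclique of level `k` and index `m`: its right side is the block of all `j ∈ B`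
with `j / 2 ^ k = m`, its left side consists of the vertices adjacent to the whole block
`{j | j / 2 ^ k = m}` but not to the whole parent block. -/
noncomputable def dyadicBiclique {α : Type*} (A : Finset α) (B : Finset ℕ) (E : Finset (α × ℕ))
    (k m : ℕ) : Finset α × Finset ℕ := by
  classical
  exact (A.filter fun i => (∀ j, j / 2 ^ k = m → (i, j) ∈ E) ∧
    ∃ j, j / 2 ^ (k + 1) = m / 2 ∧ (i, j) ∉ E, B.filter fun j => j / 2 ^ k = m)

theorem div_two_pow_succ (j k : ℕ) : j / 2 ^ (k + 1) = j / 2 ^ k / 2 := by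
  rw [pow_succ, Nat.div_div_eq_div_mul]

/-- If `p` changes its truth value only at points of `S`, then the number of maximal dyadic blocks
of level `k` on which `p` holds is at most `2 * #S`. -/
theorem card_maximal_blocks_le {p : ℕ → Prop} {S : Finset ℕ}
    (hS : ∀ j j', p j → ¬ p j' → ∃ c ∈ S, c ∈ uIcc j j') (k : ℕ) {M : Finset ℕ}
    (hM : ∀ m ∈ M, (∀ j, j / 2 ^ k = m → p j) ∧ ∃ j, j / 2 ^ (k + 1) = m / 2 ∧ ¬ p j) :
    #M ≤ 2 * #S := by
  have hsub : M ⊆ S.biUnion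
      (fun c => {2 * (c / 2 ^ (k + 1)), 2 * (c / 2 ^ (k + 1)) + 1}) := by
    intro m hm
    obtain ⟨hfull, j', hj', hnot⟩ := hM m hm
    have hm' : m * 2 ^ k / 2 ^ k = m := Nat.mul_div_cancel _ (by positivity)
    obtain ⟨c, hc, hcmem⟩ := hS _ j' (hfull _ hm') hnot
    have hpar : m * 2 ^ k / 2 ^ (k + 1) = m / 2 := by rw [div_two_pow_succ, hm']
    have hc2 : c / 2 ^ (k + 1) = m / 2 := by
      rcases Finset.mem_uIcc'.mp hcmem with ⟨h₁, h₂⟩ | ⟨h₁, h₂⟩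
      all_goals
        have h₃ := Nat.div_le_div_right (c := 2 ^ (k + 1)) h₁
        have h₄ := Nat.div_le_div_right (c := 2 ^ (k + 1)) h₂
        omega
    refine mem_biUnion.mpr ⟨c, hc, ?_⟩
    rw [hc2, mem_insert, mem_singleton]
    omega
  calc #M ≤ _ := card_le_card hsub
    _ ≤ #S * 2 := card_biUnion_le_card_mul _ _ _ fun _ _ => card_le_two
    _ = 2 * #S := mul_comm _ _

theorem sum_card_dyadicBiclique_le {α : Type*} {A : Finset α} {n c : ℕ}
    {E : Finset (α × ℕ)} {S : α → Finset ℕ} (hcard : ∀ i ∈ A, #(S i) ≤ c)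
    (hS : ∀ i ∈ A, ∀ j j', (i, j) ∈ E → (i, j') ∉ E → ∃ x ∈ S i, x ∈ uIcc j j') (k : ℕ) :
    ∑ m ∈ range (n + 1), (#(dyadicBiclique A (Icc 1 n) E k m).1 +
      #(dyadicBiclique A (Icc 1 n) E k m).2) ≤ 2 * c * #A + n := by
  classical
  rw [sum_add_distrib]
  refine Nat.add_le_add ?_ ?_
  · have hswap := sum_card_bipartiteAbove_eq_sum_card_bipartiteBelow (s := A)
      (t := range (n + 1)) (fun i m => (∀ j, j / 2 ^ k = m → (i, j) ∈ E) ∧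
        ∃ j, j / 2 ^ (k + 1) = m / 2 ∧ (i, j) ∉ E)
    have hrow : ∀ i ∈ A, #(bipartiteAbove (fun i m => (∀ j, j / 2 ^ k = m → (i, j) ∈ E) ∧
        ∃ j, j / 2 ^ (k + 1) = m / 2 ∧ (i, j) ∉ E) (range (n + 1)) i) ≤ 2 * c := by
      intro i hi
      refine (card_maximal_blocks_le (p := fun j => (i, j) ∈ E) (hS i hi) k ?_).trans
        (Nat.mul_le_mul_left 2 (hcard i hi))
      intro m hm
      exact (mem_filter.mp hm).2
    calc _ = _ := hswap.symm
      _ ≤ #A • (2 * c) := sum_le_card_nsmul _ _ _ hrow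
      _ = 2 * c * #A := by rw [smul_eq_mul, mul_comm]
  · have hfib := card_eq_sum_card_fiberwise (f := fun j => j / 2 ^ k) (s := Icc 1 n)
      (t := range (n + 1)) (fun j hj => by
        have h := Nat.div_le_self j (2 ^ k)
        simp only [coe_Icc, Set.mem_Icc, coe_range, Set.mem_Iio] at hj ⊢
        omega)
    rw [Nat.card_Icc, Nat.add_sub_cancel] at hfib
    exact hfib.symm.le

theorem isBiclique_dyadicBiclique {α : Type*} (A : Finset α) (B : Finset ℕ)
    (E : Finset (α × ℕ)) (k m : ℕ) : IsBiclique A B E (dyadicBiclique A B E k m) := by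
  classical
  refine ⟨filter_subset _ _, filter_subset _ _, ?_⟩
  rintro ⟨i, j⟩ hij
  obtain ⟨hi, hj⟩ := mem_product.mp hij
  exact (mem_filter.mp hi).2.1 j (mem_filter.mp hj).2

theorem exists_mem_dyadicBiclique {α : Type*} {A : Finset α} {n : ℕ} {E : Finset (α × ℕ)}
    (hE : E ⊆ A ×ˢ Icc 1 n) {L : ℕ} (hL : n < 2 ^ L) {i : α} {j : ℕ} (hij : (i, j) ∈ E) :
    ∃ k < L, i ∈ (dyadicBiclique A (Icc 1 n) E k (j / 2 ^ k)).1 ∧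
      j ∈ (dyadicBiclique A (Icc 1 n) E k (j / 2 ^ k)).2 := by
  classical
  obtain ⟨hi, hj⟩ := mem_product.mp (hE hij)
  have htop : ∃ j', j' / 2 ^ L = j / 2 ^ L ∧ (i, j') ∉ E := by
    refine ⟨0, ?_, fun h => ?_⟩
    · rw [Nat.zero_div, Nat.div_eq_of_lt ((mem_Icc.mp hj).2.trans_lt hL)]
    · simpa using (mem_product.mp (hE h)).2
  have hex : ∃ k, ∃ j', j' / 2 ^ k = j / 2 ^ k ∧ (i, j') ∉ E := ⟨L, htop⟩
  have hspec := Nat.find_spec hex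
  have hle : Nat.find hex ≤ L := Nat.find_min' hex htop
  have hmin := fun k => Nat.find_min hex (m := k)
  generalize Nat.find hex = k₀ at hspec hle hmin
  cases k₀ with
  | zero =>
    obtain ⟨j', hj', hnot⟩ := hspec
    simp only [pow_zero, Nat.div_one] at hj'
    exact absurd hij (hj' ▸ hnot)
  | succ k =>
    obtain ⟨j', hj', hnot⟩ := hspec
    refine ⟨k, hle, mem_filter.mpr ⟨hi, fun j'' hj'' => ?_, j', ?_, hnot⟩,
      mem_filter.mpr ⟨hj, rfl⟩⟩
    · by_contra h
      exact hmin k k.lt_succ_self ⟨j'', hj'', h⟩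
    · rw [hj', div_two_pow_succ]

/-- A bipartite graph each of whose rows changes at no more than `c` points has a biclique
covering of quasilinear weight. -/
theorem cov_le_of_row_breakpoints {α : Type*} {A : Finset α} {n c : ℕ} {E : Finset (α × ℕ)}
    (hE : E ⊆ A ×ˢ Icc 1 n) {S : α → Finset ℕ} (hcard : ∀ i ∈ A, #(S i) ≤ c)
    (hS : ∀ i ∈ A, ∀ j j', (i, j) ∈ E → (i, j') ∉ E → ∃ x ∈ S i, x ∈ uIcc j j')
    {L : ℕ} (hL : n < 2 ^ L) :
    Cov A (Icc 1 n) E ≤ L * (2 * c * #A + n) := by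
  classical
  let f : ℕ × ℕ → Finset α × Finset ℕ := fun x => dyadicBiclique A (Icc 1 n) E x.1 x.2
  have hcover : IsBicliqueCover A (Icc 1 n) E ((range L ×ˢ range (n + 1)).image f) := by
    refine ⟨fun p hp => ?_, ?_⟩
    · obtain ⟨x, -, rfl⟩ := mem_image.mp hp
      exact isBiclique_dyadicBiclique _ _ _ _ _
    · rintro ⟨i, j⟩ hij
      obtain ⟨k, hk, hmem⟩ := exists_mem_dyadicBiclique hE hL hij
      refine ⟨f (k, j / 2 ^ k), mem_image_of_mem f (mem_product.mpr ⟨mem_range.mpr hk, ?_⟩),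
        hmem⟩
      have hj := (mem_Icc.mp (mem_product.mp (hE hij)).2).2
      exact mem_range.mpr (Nat.lt_succ_of_le ((Nat.div_le_self _ _).trans hj))
  calc Cov A (Icc 1 n) E
      ≤ ∑ p ∈ (range L ×ˢ range (n + 1)).image f, (#p.1 + #p.2) :=
        Nat.sInf_le ⟨_, hcover, rfl⟩
    _ ≤ ∑ x ∈ range L ×ˢ range (n + 1), (#(f x).1 + #(f x).2) :=
        sum_image_le_of_nonneg (fun _ _ => Nat.zero_le _)
    _ = ∑ k ∈ range L, ∑ m ∈ range (n + 1), (#(f (k, m)).1 + #(f (k, m)).2) :=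
        sum_product _ _ _
    _ ≤ ∑ _k ∈ range L, (2 * c * #A + n) :=
        sum_le_sum fun k _ => sum_card_dyadicBiclique_le hcard hS k
    _ = L * (2 * c * #A + n) := by rw [sum_const, card_range, smul_eq_mul]

theorem deltaEdges_breakpoints (n : ℕ) {i j j' : ℕ} (hj : (i, j) ∈ deltaEdges n)
    (hj' : (i, j') ∉ deltaEdges n) :
    ∃ x ∈ ({1, n, i - n / 4, i + n / 4, i + (n - n / 4), i - (n - n / 4)} : Finset ℕ),
      x ∈ uIcc j j' := by
  simp only [deltaEdges, mem_filter, mem_product, mem_Icc] at hj hj'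
  simp only [Nat.dist] at hj hj'
  simp only [mem_insert, mem_singleton, exists_eq_or_imp, exists_eq_left, Finset.mem_uIcc']
  omega

theorem cov_deltaEdges_le (n : ℕ) :
    Cov (Icc 1 n) (Icc 1 n) (deltaEdges n) ≤ (Nat.log 2 n + 1) * (13 * n) := by
  refine (cov_le_of_row_breakpoints (c := 6) (filter_subset _ _) (fun i _ => card_le_six)
    (fun i _ j j' => deltaEdges_breakpoints n) (Nat.lt_pow_succ_log_self one_lt_two n)).trans
    (le_of_eq ?_)
  rw [Nat.card_Icc, Nat.add_sub_cancel, Nat.succ_eq_add_one]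
  ring

/-- for every `ε > 0` there is a constant `C > 0`, depending only on `ε`,
such that for every positive integer `n`, `Cov(G_Δ^n) ≤ C · n^(1+ε)`. -/
theorem cov_deltaGraph :
    ∀ ε : ℝ, 0 < ε → ∃ C : ℝ, 0 < C ∧ ∀ n : ℕ, 1 ≤ n →
      (Cov (Finset.Icc 1 n) (Finset.Icc 1 n) (deltaEdges n) : ℝ) ≤
        C * (n : ℝ) ^ (1 + ε) := by
  intro ε hε
  have hlog2 : 0 < Real.log 2 := Real.log_pos one_lt_two
  refine ⟨13 * (1 / (ε * Real.log 2) + 1), by positivity, fun n hn => ?_⟩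
  have hn₁ : (1 : ℝ) ≤ n := by exact_mod_cast hn
  have hn₀ : (0 : ℝ) < n := by linarith
  have hpow : (1 : ℝ) ≤ (n : ℝ) ^ ε := Real.one_le_rpow hn₁ hε.le
  have hlog : (Nat.log 2 n : ℝ) ≤ (n : ℝ) ^ ε * (1 / (ε * Real.log 2)) := by
    calc (Nat.log 2 n : ℝ) ≤ Real.logb 2 n := by exact_mod_cast Real.natLog_le_logb n 2
      _ = Real.log n / Real.log 2 := rfl
      _ ≤ (n : ℝ) ^ ε / ε / Real.log 2 := by
        gcongr
        exact Real.log_le_rpow_div hn₀.le hε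
      _ = (n : ℝ) ^ ε * (1 / (ε * Real.log 2)) := by field_simp
  calc (Cov (Icc 1 n) (Icc 1 n) (deltaEdges n) : ℝ)
      ≤ (Nat.log 2 n + 1) * (13 * n) := by exact_mod_cast cov_deltaEdges_le n
    _ ≤ ((n : ℝ) ^ ε * (1 / (ε * Real.log 2)) + (n : ℝ) ^ ε) * (13 * n) := by gcongr
    _ = 13 * (1 / (ε * Real.log 2) + 1) * (n : ℝ) ^ (1 + ε) := by
      rw [Real.rpow_add hn₀, Real.rpow_one]
      ring
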